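/- Let A be a real l×m matrix satisfying the RIP of order 2s with constant δ₂ₛ ∈ (0,1). Let h⋆ ∈ ℝᵐ have at most s nonzero entries and set y = A h⋆. Let S ⊆ {1,…,m} with |S| ≤ s, and let ĥ be a minimizer of ‖y − A u‖₂ over all u ∈ ℝᵐ with support contained in S. Then the restriction of ĥ − h⋆ to S satisfies ‖(ĥ − h⋆)|_S‖₂ ≤ δ₂ₛ · ‖ĥ − h⋆‖₂. -/

import Mathlib

open Matrix
open scoped BigOperators

/-- The Euclidean (ℓ₂) norm of a vector in ℝⁿ. -/
noncomputable def l2norm {n : ℕ} (x : Fin n → ℝ) : ℝ := Real.sqrt (∑ i, (x i)^2)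

/-- A vector has at most `s` nonzero entries. -/
def IsSparse {m : ℕ} (s : ℕ) (x : Fin m → ℝ) : Prop :=
  (Finset.univ.filter fun i => x i ≠ 0).card ≤ s

/-- `A` satisfies the restricted isometry property of order `k` with constant `δ`. -/
def SatisfiesRIP {l m : ℕ} (A : Matrix (Fin l) (Fin m) ℝ) (k : ℕ) (δ : ℝ) : Prop :=
  ∀ x : Fin m → ℝ, IsSparse k x →
    (1 - δ) * (l2norm x)^2 ≤ (l2norm (A *ᵥ x))^2 ∧
      (l2norm (A *ᵥ x))^2 ≤ (1 + δ) * (l2norm x)^2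

/-- `S` is a set of `s` largest-magnitude indices of `h`. -/
def IsLargestIndices {m : ℕ} (s : ℕ) (h : Fin m → ℝ) (S : Finset (Fin m)) : Prop :=
  S.card = s ∧ ∀ i ∈ S, ∀ j ∉ S, |h j| ≤ |h i|

/-- The restriction of `v` to `S`: equal to `v` on `S` and zero outside `S`. -/
def restrictVec {m : ℕ} (S : Finset (Fin m)) (v : Fin m → ℝ) : Fin m → ℝ :=
  fun i => if i ∈ S then v i else 0

/-- `hhat` minimizes `‖y − A u‖₂` over all `u` with support contained in `S`. -/
def IsLSMinimizerOn {l m : ℕ} (A : Matrix (Fin l) (Fin m) ℝ) (y : Fin l → ℝ)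
    (S : Finset (Fin m)) (hhat : Fin m → ℝ) : Prop :=
  (∀ i, hhat i ≠ 0 → i ∈ S) ∧
  ∀ u : Fin m → ℝ, (∀ i, u i ≠ 0 → i ∈ S) →
    l2norm (y - A *ᵥ hhat) ≤ l2norm (y - A *ᵥ u)

theorem l2norm_nonneg {n : ℕ} (x : Fin n → ℝ) : 0 ≤ l2norm x := Real.sqrt_nonneg _

theorem l2norm_sq {n : ℕ} (x : Fin n → ℝ) : l2norm x ^ 2 = x ⬝ᵥ x := by
  rw [l2norm, Real.sq_sqrt (Finset.sum_nonneg fun i _ => sq_nonneg _)]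
  simp [dotProduct, sq]

theorem dotProduct_restrictVec_self {m : ℕ} (S : Finset (Fin m)) (v : Fin m → ℝ) :
    v ⬝ᵥ restrictVec S v = l2norm (restrictVec S v) ^ 2 := by
  rw [l2norm_sq]
  refine Finset.sum_congr rfl fun i _ => ?_
  by_cases hi : i ∈ S <;> simp [restrictVec, hi]

theorem isSparse_of_support_subset {m k : ℕ} {x : Fin m → ℝ} {T : Finset (Fin m)}
    (hT : T.card ≤ k) (hx : ∀ i, x i ≠ 0 → i ∈ T) : IsSparse k x :=
  (Finset.card_le_card fun i hi => hx i (Finset.mem_filter.1 hi).2).trans hT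

/-- The RIP controls the defect of inner products of vectors with a common small support. -/
theorem SatisfiesRIP.dotProduct_sub_le {l m k : ℕ} {A : Matrix (Fin l) (Fin m) ℝ} {δ : ℝ}
    (hA : SatisfiesRIP A k δ) {T : Finset (Fin m)} (hT : T.card ≤ k)
    {a b : Fin m → ℝ} (ha : ∀ i, a i ≠ 0 → i ∈ T) (hb : ∀ i, b i ≠ 0 → i ∈ T) :
    a ⬝ᵥ b - (A *ᵥ a) ⬝ᵥ (A *ᵥ b) ≤ δ * (l2norm a * l2norm b) := by
  have hsparse (c d : ℝ) : IsSparse k (c • a + d • b) := by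
    refine isSparse_of_support_subset hT fun i hi => ?_
    by_contra hiT
    have hai : a i = 0 := not_not.1 (mt (ha i) hiT)
    have hbi : b i = 0 := not_not.1 (mt (hb i) hiT)
    simp [hai, hbi] at hi
  have key (c d : ℝ) :
      2 * (c * d) * (a ⬝ᵥ b - (A *ᵥ a) ⬝ᵥ (A *ᵥ b)) ≤
        δ * (c ^ 2 * l2norm a ^ 2 + d ^ 2 * l2norm b ^ 2) := by
    have h₁ := (hA _ (hsparse c d)).1
    have h₂ := (hA _ (hsparse c (-d))).2
    simp only [l2norm_sq, mulVec_add, mulVec_smul, add_dotProduct, dotProduct_add,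
      smul_dotProduct, dotProduct_smul, smul_eq_mul, dotProduct_comm b a,
      dotProduct_comm (A *ᵥ b) (A *ᵥ a)] at h₁ h₂ ⊢
    linarith
  have hzero {n : ℕ} {x : Fin n → ℝ} (hx : l2norm x = 0) : x = 0 := by
    rw [← dotProduct_self_eq_zero, ← l2norm_sq, hx]
    norm_num
  rcases (l2norm_nonneg a).eq_or_lt with ha0 | ha0
  · simp [hzero ha0.symm, l2norm]
  rcases (l2norm_nonneg b).eq_or_lt with hb0 | hb0
  · simp [hzero hb0.symm, l2norm]
  have h := key (l2norm b) (l2norm a)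
  have hpos : 0 < 2 * (l2norm b * l2norm a) := by positivity
  refine le_of_mul_le_mul_left (h.trans_eq ?_) hpos
  ring

/-- The residual of a least-squares fit on `S` is orthogonal to the image of vectors
supported in `S`. -/
theorem IsLSMinimizerOn.residual_dotProduct_eq_zero {l m : ℕ} {A : Matrix (Fin l) (Fin m) ℝ}
    {y : Fin l → ℝ} {S : Finset (Fin m)} {x : Fin m → ℝ} (hx : IsLSMinimizerOn A y S x)
    {v : Fin m → ℝ} (hv : ∀ i, v i ≠ 0 → i ∈ S) : (y - A *ᵥ x) ⬝ᵥ (A *ᵥ v) = 0 := by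
  have h (t : ℝ) : 0 ≤ ((A *ᵥ v) ⬝ᵥ (A *ᵥ v)) * (t * t) +
      (-2 * ((y - A *ᵥ x) ⬝ᵥ (A *ᵥ v))) * t + 0 := by
    have hle := hx.2 (x + t • v) fun i hi => by
      by_contra hiS
      have hxi : x i = 0 := not_not.1 (mt (hx.1 i) hiS)
      have hvi : v i = 0 := not_not.1 (mt (hv i) hiS)
      simp [hxi, hvi] at hi
    have hsq := pow_le_pow_left₀ (l2norm_nonneg _) hle 2
    rw [mulVec_add, mulVec_smul, ← sub_sub, l2norm_sq, l2norm_sq] at hsq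
    generalize y - A *ᵥ x = r at hsq ⊢
    simp only [sub_dotProduct, dotProduct_sub, smul_dotProduct, dotProduct_smul, smul_eq_mul,
      dotProduct_comm (A *ᵥ v) r] at hsq
    linarith
  have hd := discrim_le_zero h
  rw [discrim] at hd
  exact pow_eq_zero_iff two_ne_zero |>.1 (by nlinarith [sq_nonneg ((y - A *ᵥ x) ⬝ᵥ (A *ᵥ v))])

/-- On-support error bound for the restricted least-squares estimate. -/
theorem ls_on_support_error_bound
    (l m s : ℕ) (A : Matrix (Fin l) (Fin m) ℝ) (δ₂ : ℝ)
    (hδ₂0 : 0 < δ₂) (hδ₂1 : δ₂ < 1)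
    (hRIP2 : SatisfiesRIP A (2*s) δ₂)
    (hstar : Fin m → ℝ) (hstar_sparse : IsSparse s hstar)
    (y : Fin l → ℝ) (hy : y = A *ᵥ hstar)
    (S : Finset (Fin m)) (hS : S.card ≤ s)
    (hhat : Fin m → ℝ) (hhat_min : IsLSMinimizerOn A y S hhat) :
    l2norm (restrictVec S (hhat - hstar)) ≤ δ₂ * l2norm (hhat - hstar) := by
  set e := hhat - hstar with he
  set r := restrictVec S e with hr
  have hrS : ∀ i, r i ≠ 0 → i ∈ S := fun i hi => by
    by_contra hiS
    simp [hr, restrictVec, hiS] at hi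
  have horth : (A *ᵥ e) ⬝ᵥ (A *ᵥ r) = 0 := by
    have h := hhat_min.residual_dotProduct_eq_zero hrS
    rwa [hy, ← mulVec_sub, ← neg_sub, mulVec_neg, neg_dotProduct, neg_eq_zero] at h
  let T := S ∪ Finset.univ.filter fun i => hstar i ≠ 0
  have hT : T.card ≤ 2 * s :=
    (Finset.card_union_le _ _).trans ((add_le_add hS hstar_sparse).trans_eq (two_mul s).symm)
  have heT : ∀ i, e i ≠ 0 → i ∈ T := fun i hi => by
    by_cases hstar_i : hstar i = 0
    · exact Finset.mem_union_left _ (hhat_min.1 i (by simpa [he, hstar_i] using hi))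
    · exact Finset.mem_union_right _ (by simpa using hstar_i)
  have h := hRIP2.dotProduct_sub_le hT heT fun i hi =>
    Finset.mem_union_left _ (hrS i hi)
  rw [horth, dotProduct_restrictVec_self, sub_zero, ← hr] at h
  rcases (l2norm_nonneg r).eq_or_lt with hr0 | hr0
  · rw [← hr0]
    exact mul_nonneg hδ₂0.le (l2norm_nonneg _)
  · exact le_of_mul_le_mul_right (by linarith) hr0
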